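/- (Theorem 4, testable implication of parallel trends in pre-effective-treatment periods.) Let (Ω, 𝔉, P) be a probability space, ℋ ⊆ 𝔉 and 𝒟σ ⊆ 𝔉 sub-σ-algebras, M, S ∈ 𝒟σ disjoint events with P(M) > 0, and let r be a natural number with 2 ≤ r ≤ s < t (a pre-period). Let Y⁰_r, Y⁰_{r−1} be integrable untreated potential outcomes and Yobs_r, Yobs_{r−1} integrable observed outcomes, and assume: (i) Yobs_r = Y⁰_r and Yobs_{r−1} = Y⁰_{r−1} almost everywhere on M ∪ S (movers and stayers between s and t are untreated in periods r−1 and r); (ii) conditional parallel trends: E[Y⁰_r − Y⁰_{r−1} ∣ 𝒟σ ⊔ ℋ] = E[Y⁰_r − Y⁰_{r−1} ∣ ℋ] a.s.; (iii) overlap: there is ε > 0 with ε ≤ E[1_S ∣ ℋ] ≤ 1 − ε and ε ≤ p ≤ 1 − ε a.s., where p := E[1_M ∣ ℋ]/(E[1_M ∣ ℋ] + E[1_S ∣ ℋ]); set rr := p/(1 − p). Let m_r be an ℋ-measurable integrable function with m_r · E[1_S ∣ ℋ] = E[1_S · (Yobs_r − Yobs_{r−1}) ∣ ℋ] a.s.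 Then both the pre-period ATEM and the pre-period DR estimand vanish: E[Yobs_r − Y⁰_r ∣ M] = 0 and E[(1_M / P(M) − rr · 1_S / E[rr · 1_S]) · ((Yobs_r − Yobs_{r−1}) − m_r)] = 0. -/

import Mathlib

open MeasureTheory

/-- The generalized propensity score `p = E[1_M ∣ ℋ] / (E[1_M ∣ ℋ] + E[1_S ∣ ℋ])`. -/
noncomputable def gps {Ω : Type*} {𝔉 : MeasurableSpace Ω} (P : Measure Ω)
    (ℋ : MeasurableSpace Ω) (M S : Set Ω) : Ω → ℝ := fun ω =>
  (P[M.indicator (fun _ => (1 : ℝ)) | ℋ]) ω /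
    ((P[M.indicator (fun _ => (1 : ℝ)) | ℋ]) ω + (P[S.indicator (fun _ => (1 : ℝ)) | ℋ]) ω)

/-- The odds ratio `rr = p / (1 − p)` of the generalized propensity score. -/
noncomputable def gpsOdds {Ω : Type*} {𝔉 : MeasurableSpace Ω} (P : Measure Ω)
    (ℋ : MeasurableSpace Ω) (M S : Set Ω) : Ω → ℝ := fun ω =>
  gps P ℋ M S ω / (1 - gps P ℋ M S ω)

/-- A bounded `m`-measurable weight is orthogonal to the residual `f - P[f|m]`. -/
theorem integral_bdd_mul_sub_condExp_eq_zero {Ω : Type*} {m m0 : MeasurableSpace Ω}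
    {P : Measure Ω} [IsFiniteMeasure P] (hm : m ≤ m0) {w f : Ω → ℝ} {C : ℝ}
    (hw : StronglyMeasurable[m] w) (hC : ∀ᵐ ω ∂P, ‖w ω‖ ≤ C) (hf : Integrable f P) :
    ∫ ω, w ω * (f ω - (P[f | m]) ω) ∂P = 0 := by
  have hw0 : AEStronglyMeasurable w P := (hw.mono hm).aestronglyMeasurable
  have hwf : Integrable (w * f) P := hf.bdd_mul hw0 hC
  have hwc : Integrable (w * P[f | m]) P := integrable_condExp.bdd_mul hw0 hC
  have hpull : P[w * f | m] =ᵐ[P] w * P[f | m] :=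
    condExp_mul_of_stronglyMeasurable_left hw hwf hf
  have heq : ∫ ω, (w * f) ω ∂P = ∫ ω, (w * P[f | m]) ω ∂P := by
    rw [← integral_condExp hm (f := w * f)]
    exact integral_congr_ae hpull
  simp only [mul_sub]
  exact (integral_sub hwf hwc).trans (sub_eq_zero.2 heq)

/-- If conditioning `f` on `𝒢 ≥ ℋ` gives nothing beyond `ℋ`, then the conditional expectation
of `f` on a `𝒢`-measurable event factors. -/
theorem condExp_indicator_mul_ae_eq_mul_condExp {Ω : Type*} {ℋ 𝒢 m0 : MeasurableSpace Ω}
    {P : Measure Ω} [IsFiniteMeasure P] (hℋ : ℋ ≤ 𝒢) (h𝒢 : 𝒢 ≤ m0) {A : Set Ω}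
    (hA : MeasurableSet[𝒢] A) {f : Ω → ℝ} (hf : Integrable f P)
    (hcond : P[f | 𝒢] =ᵐ[P] P[f | ℋ]) :
    P[A.indicator (fun _ => (1 : ℝ)) * f | ℋ]
      =ᵐ[P] P[f | ℋ] * P[A.indicator (fun _ => (1 : ℝ)) | ℋ] := by
  set a : Ω → ℝ := A.indicator (fun _ => (1 : ℝ)) with ha
  have ha_meas : StronglyMeasurable[𝒢] a := stronglyMeasurable_const.indicator hA
  have ha0 : AEStronglyMeasurable a P := (ha_meas.mono h𝒢).aestronglyMeasurable
  have ha_bdd : ∀ᵐ ω ∂P, ‖a ω‖ ≤ 1 := .of_forall fun ω =>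
    (norm_indicator_le_norm_self _ ω).trans (by simp)
  have ha_int : Integrable a P := (integrable_const 1).indicator (h𝒢 _ hA)
  have haf : Integrable (a * f) P := hf.bdd_mul ha0 ha_bdd
  have hga : Integrable (P[f | ℋ] * a) P := integrable_condExp.mul_bdd ha0 ha_bdd
  have hinner : P[a * f | 𝒢] =ᵐ[P] P[f | ℋ] * a := by
    filter_upwards [condExp_mul_of_stronglyMeasurable_left ha_meas haf hf, hcond] with ω h1 h2
    rw [h1, Pi.mul_apply, Pi.mul_apply, h2, mul_comm]
  calc P[a * f | ℋ] =ᵐ[P] P[P[a * f | 𝒢] | ℋ] := (condExp_condExp_of_le hℋ h𝒢).symm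
    _ =ᵐ[P] P[P[f | ℋ] * a | ℋ] := condExp_congr_ae hinner
    _ =ᵐ[P] P[f | ℋ] * P[a | ℋ] :=
      condExp_mul_of_stronglyMeasurable_left stronglyMeasurable_condExp hga ha_int

theorem stronglyMeasurable_gpsOdds {Ω : Type*} {𝔉 : MeasurableSpace Ω} (P : Measure Ω)
    (ℋ : MeasurableSpace Ω) (M S : Set Ω) : StronglyMeasurable[ℋ] (gpsOdds P ℋ M S) := by
  have hgps : Measurable[ℋ] (gps P ℋ M S) :=
    stronglyMeasurable_condExp.measurable.div
      (stronglyMeasurable_condExp.measurable.add stronglyMeasurable_condExp.measurable)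
  exact (hgps.div (hgps.const_sub 1)).stronglyMeasurable

/-- Overlap bounds the odds ratio. -/
theorem norm_gpsOdds_le {Ω : Type*} {𝔉 : MeasurableSpace Ω} {P : Measure Ω}
    {ℋ : MeasurableSpace Ω} {M S : Set Ω} {ε : ℝ} (hε : 0 < ε) {ω : Ω}
    (hlo : ε ≤ gps P ℋ M S ω) (hhi : gps P ℋ M S ω ≤ 1 - ε) :
    ‖gpsOdds P ℋ M S ω‖ ≤ 1 / ε := by
  have hnonneg : 0 ≤ gpsOdds P ℋ M S ω := div_nonneg (by linarith) (by linarith)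
  rw [Real.norm_of_nonneg hnonneg]
  exact div_le_div₀ zero_le_one (by linarith) hε (by linarith)

/-- Theorem 4 (testable implication of parallel trends in pre-effective-treatment periods):
in any pre-period `r` with `2 ≤ r ≤ s < t`, both the pre-period ATEM and the pre-period DR
estimand vanish. -/
theorem pre_trends_testable_implication
    {Ω : Type*} {𝔉 : MeasurableSpace Ω} (P : Measure Ω) [IsProbabilityMeasure P]
    (ℋ 𝒟σ : MeasurableSpace Ω) (hℋ : ℋ ≤ 𝔉) (h𝒟 : 𝒟σ ≤ 𝔉)
    (M S : Set Ω) (hM : MeasurableSet[𝒟σ] M) (hS : MeasurableSet[𝒟σ] S)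
    (hMS : Disjoint M S) (hPM : 0 < P M)
    (r s t : ℕ) (hr2 : 2 ≤ r) (hrs : r ≤ s) (hst : s < t)
    (Y0_r Y0_rm1 : Ω → ℝ) (hY0r : Integrable Y0_r P) (hY0rm1 : Integrable Y0_rm1 P)
    (Yobs_r Yobs_rm1 : Ω → ℝ) (hYr : Integrable Yobs_r P) (hYrm1 : Integrable Yobs_rm1 P)
    (hcons_r : ∀ᵐ ω ∂P, ω ∈ M ∪ S → Yobs_r ω = Y0_r ω)
    (hcons_rm1 : ∀ᵐ ω ∂P, ω ∈ M ∪ S → Yobs_rm1 ω = Y0_rm1 ω)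
    (hpt : P[fun ω => Y0_r ω - Y0_rm1 ω | 𝒟σ ⊔ ℋ]
        =ᵐ[P] P[fun ω => Y0_r ω - Y0_rm1 ω | ℋ])
    (ε : ℝ) (hε : 0 < ε)
    (hoverS : ∀ᵐ ω ∂P, ε ≤ (P[S.indicator (fun _ => (1 : ℝ)) | ℋ]) ω
        ∧ (P[S.indicator (fun _ => (1 : ℝ)) | ℋ]) ω ≤ 1 - ε)
    (hoverp : ∀ᵐ ω ∂P, ε ≤ gps P ℋ M S ω ∧ gps P ℋ M S ω ≤ 1 - ε)
    (m_r : Ω → ℝ) (hm_meas : Measurable[ℋ] m_r) (hm_int : Integrable m_r P)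
    (hm : (fun ω => m_r ω * (P[S.indicator (fun _ => (1 : ℝ)) | ℋ]) ω)
        =ᵐ[P] P[fun ω => S.indicator (fun _ => (1 : ℝ)) ω * (Yobs_r ω - Yobs_rm1 ω) | ℋ]) :
    (∫ ω in M, (Yobs_r ω - Y0_r ω) ∂P) / (P M).toReal = 0
    ∧ (∫ ω, (M.indicator (fun _ => (1 : ℝ)) ω / (P M).toReal
          - gpsOdds P ℋ M S ω * S.indicator (fun _ => (1 : ℝ)) ω
              / (∫ ω', gpsOdds P ℋ M S ω' * S.indicator (fun _ => (1 : ℝ)) ω' ∂P))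
          * ((Yobs_r ω - Yobs_rm1 ω) - m_r ω) ∂P) = 0 := by
  have h𝒢 : 𝒟σ ⊔ ℋ ≤ 𝔉 := sup_le h𝒟 hℋ
  have hM𝒢 : MeasurableSet[𝒟σ ⊔ ℋ] M := le_sup_left (b := ℋ) M hM
  have hS𝒢 : MeasurableSet[𝒟σ ⊔ ℋ] S := le_sup_left (b := ℋ) S hS
  refine ⟨?_, ?_⟩
  · rw [setIntegral_congr_ae (g := fun _ => (0 : ℝ)) (h𝒟 _ hM)]
    · simp
    · filter_upwards [hcons_r] with ω h hω
      rw [h (Or.inl hω), sub_self]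
  set Δ : Ω → ℝ := fun ω => Y0_r ω - Y0_rm1 ω with hΔ
  have hΔ_int : Integrable Δ P := hY0r.sub hY0rm1
  have hm_eq : m_r =ᵐ[P] P[Δ | ℋ] := by
    have hobs : (fun ω => S.indicator (fun _ => (1 : ℝ)) ω * (Yobs_r ω - Yobs_rm1 ω))
        =ᵐ[P] S.indicator (fun _ => (1 : ℝ)) * Δ := by
      filter_upwards [hcons_r, hcons_rm1] with ω h1 h2
      by_cases hω : ω ∈ S
      · simp [hΔ, h1 (Or.inr hω), h2 (Or.inr hω)]
      · simp [hω]
    filter_upwards [hm, condExp_congr_ae (m := ℋ) hobs, hoverS,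
      condExp_indicator_mul_ae_eq_mul_condExp le_sup_right h𝒢 hS𝒢 hΔ_int hpt] with ω h1 h2 h3 h4
    rw [h2, h4, Pi.mul_apply] at h1
    exact mul_right_cancel₀ (hε.trans_le h3.1).ne' h1
  generalize ∫ ω', gpsOdds P ℋ M S ω' * S.indicator (fun _ => (1 : ℝ)) ω' ∂P = c
  set w : Ω → ℝ := fun ω => M.indicator (fun _ => (1 : ℝ)) ω / (P M).toReal
    - gpsOdds P ℋ M S ω * S.indicator (fun _ => (1 : ℝ)) ω / c with hw
  have hw_meas : StronglyMeasurable[𝒟σ ⊔ ℋ] w := by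
    have h1 : Measurable[𝒟σ ⊔ ℋ] (M.indicator (fun _ => (1 : ℝ))) :=
      measurable_const.indicator hM𝒢
    have h2 : Measurable[𝒟σ ⊔ ℋ] (S.indicator (fun _ => (1 : ℝ))) :=
      measurable_const.indicator hS𝒢
    have h3 : Measurable[𝒟σ ⊔ ℋ] (gpsOdds P ℋ M S) :=
      ((stronglyMeasurable_gpsOdds P ℋ M S).mono le_sup_right).measurable
    exact ((h1.div_const _).sub ((h3.mul h2).div_const c)).stronglyMeasurable
  have hw_bdd : ∀ᵐ ω ∂P, ‖w ω‖ ≤ 1 / ‖(P M).toReal‖ + 1 / ε * 1 / ‖c‖ := by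
    filter_upwards [hoverp] with ω h
    have hind : ∀ A : Set Ω, ‖A.indicator (fun _ => (1 : ℝ)) ω‖ ≤ 1 := fun A =>
      (norm_indicator_le_norm_self _ ω).trans (by simp)
    refine (norm_sub_le _ _).trans ?_
    rw [norm_div, norm_div, norm_mul]
    gcongr
    exacts [hind M, norm_gpsOdds_le hε h.1 h.2, hind S]
  rw [← integral_bdd_mul_sub_condExp_eq_zero h𝒢 hw_meas hw_bdd hΔ_int]
  refine integral_congr_ae ?_
  filter_upwards [hcons_r, hcons_rm1, hm_eq, hpt] with ω h1 h2 h3 h4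
  by_cases hω : ω ∈ M ∪ S
  · simp only [hΔ] at h3 h4 ⊢
    rw [h1 hω, h2 hω, h3, h4]
  · have hwω : w ω = 0 := by
      rw [Set.mem_union, not_or] at hω
      simp [hw, hω.1, hω.2]
    change w ω * _ = w ω * _
    rw [hwω, zero_mul, zero_mul]
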